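/- arXiv:1011.6313 — 2 statements merged into one kernel-verified Lean document; each statement's English description precedes it below -/
import Mathlib

section
/- For positive definite matrices A, B and 1 ≤ p ≤ 2, the p-power mean μ_p(A,B) = ((A^p + B^p)/2)^(1/p) satisfies the in-betweenness property with respect to the Euclidean (Hilbert–Schmidt) distance: trace((A - μ_p(A,B))²) ≤ trace((A - B)²). -/
open Matrix MeasureTheory
open scoped ComplexOrder

/-- Apply a real function to a Hermitian matrix via the spectral decomposition. -/
noncomputable def matFun {n : ℕ} (A : Matrix (Fin n) (Fin n) ℂ) (hA : A.IsHermitian)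
    (g : ℝ → ℝ) : Matrix (Fin n) (Fin n) ℂ :=
  (hA.eigenvectorUnitary : Matrix (Fin n) (Fin n) ℂ) *
    Matrix.diagonal (fun i => (g (hA.eigenvalues i) : ℂ)) *
    star (hA.eigenvectorUnitary : Matrix (Fin n) (Fin n) ℂ)

/-- Real power of a Hermitian matrix via the spectral decomposition. -/
noncomputable def mpow {n : ℕ} (A : Matrix (Fin n) (Fin n) ℂ) (hA : A.IsHermitian)
    (p : ℝ) : Matrix (Fin n) (Fin n) ℂ :=
  matFun A hA (fun x => x ^ p)

/-- Hilbert-Schmidt (Frobenius) norm of a matrix. -/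
noncomputable def frob {n : ℕ} (X : Matrix (Fin n) (Fin n) ℂ) : ℝ :=
  Real.sqrt (Matrix.trace (star X * X)).re
open scoped MatrixOrder Matrix.Norms.L2Operator in
theorem mpow_eq_rpow {n : ℕ} {A : Matrix (Fin n) (Fin n) ℂ} (hA : A.IsHermitian)
    (hA0 : 0 ≤ A) (p : ℝ) : mpow A hA p = A ^ p := by
  rw [CFC.rpow_eq_cfc_real hA0, hA.cfc_eq]
  rfl

theorem re_trace_cfc_mul_cfc {n : ℕ} {X Y : Matrix (Fin n) (Fin n) ℂ}
    (hX : X.IsHermitian) (hY : Y.IsHermitian) (f g : ℝ → ℝ) :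
    (trace (cfc f X * cfc g Y)).re = ∑ i, ∑ j, f (hX.eigenvalues i) * g (hY.eigenvalues j) *
      Complex.normSq ((star (hX.eigenvectorUnitary : Matrix (Fin n) (Fin n) ℂ) *
        (hY.eigenvectorUnitary : Matrix (Fin n) (Fin n) ℂ)) i j) := by
  set U : Matrix (Fin n) (Fin n) ℂ := (hX.eigenvectorUnitary : Matrix (Fin n) (Fin n) ℂ)
  set V : Matrix (Fin n) (Fin n) ℂ := (hY.eigenvectorUnitary : Matrix (Fin n) (Fin n) ℂ)
  have hXf : cfc f X = U * diagonal (fun i => (f (hX.eigenvalues i) : ℂ)) * star U := by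
    rw [hX.cfc_eq]; rfl
  have hYg : cfc g Y = V * diagonal (fun i => (g (hY.eigenvalues i) : ℂ)) * star V := by
    rw [hY.cfc_eq]; rfl
  have key : trace (cfc f X * cfc g Y) =
      trace (diagonal (fun i => (f (hX.eigenvalues i) : ℂ)) * (star U * V) *
        (diagonal (fun i => (g (hY.eigenvalues i) : ℂ)) * star (star U * V))) := by
    rw [hXf, hYg, star_mul, star_star]
    simp only [mul_assoc]
    rw [trace_mul_comm U]
    simp only [mul_assoc]
  rw [key]
  generalize star U * V = W
  simp only [trace, diag_apply]
  simp_rw [mul_apply (M := diagonal _ * W), diagonal_mul, star_apply, Complex.re_sum]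
  refine Finset.sum_congr rfl fun i _ => Finset.sum_congr rfl fun j _ => ?_
  rw [show ((f (hX.eigenvalues i) : ℂ) * W i j * (g (hY.eigenvalues j) * star (W i j))) =
    ((f (hX.eigenvalues i) * g (hY.eigenvalues j) : ℝ) : ℂ) * (W i j * star (W i j)) by
      push_cast; ring]
  rw [Complex.star_def, Complex.mul_conj, ← Complex.ofReal_mul, Complex.ofReal_re]

theorem rpow_tangent_le {x y q : ℝ} (hx : 0 ≤ x) (hy : 0 < y) (hq : 1 ≤ q) :
    y ^ q + q * y ^ (q - 1) * (x - y) ≤ x ^ q := by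
  have h := one_add_mul_self_le_rpow_one_add (s := x / y - 1)
    (by have := div_nonneg hx hy.le; linarith) hq
  rw [add_sub_cancel, Real.div_rpow hx hy.le, le_div_iff₀ (by positivity)] at h
  rw [Real.rpow_sub_one hy.ne']
  refine le_trans (le_of_eq ?_) h
  field_simp

/-- Klein's inequality for the power function. -/
theorem klein_rpow {n : ℕ} {X Y : Matrix (Fin n) (Fin n) ℂ}
    (hX : X.PosSemidef) (hY : Y.PosDef) {q : ℝ} (hq : 1 ≤ q) :
    (trace (cfc (fun x : ℝ => x ^ q) Y)).re +
      (trace ((X - Y) * cfc (fun x : ℝ => q * x ^ (q - 1)) Y)).re ≤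
      (trace (cfc (fun x : ℝ => x ^ q) X)).re := by
  have hXs : IsSelfAdjoint X := hX.1
  have hYs : IsSelfAdjoint Y := hY.1
  have hX1 : cfc (fun _ : ℝ => (1 : ℝ)) X = 1 := cfc_const_one ℝ X
  have hY1 : cfc (fun _ : ℝ => (1 : ℝ)) Y = 1 := cfc_const_one ℝ Y
  have hXid : cfc (fun x : ℝ => x) X = X := cfc_id' ℝ X
  have hYid : cfc (fun x : ℝ => x) Y = Y := cfc_id' ℝ Y
  have e1 := re_trace_cfc_mul_cfc hX.1 hY.1 (fun x => x ^ q) (fun _ => 1)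
  have e2 := re_trace_cfc_mul_cfc hX.1 hY.1 (fun _ => 1) (fun y => y ^ q)
  have e3 := re_trace_cfc_mul_cfc hX.1 hY.1 (fun x => x) (fun y => q * y ^ (q - 1))
  have e4 := re_trace_cfc_mul_cfc hX.1 hY.1 (fun _ => 1) (fun y => y * (q * y ^ (q - 1)))
  have e5 : cfc (fun y : ℝ => y * (q * y ^ (q - 1))) Y =
      Y * cfc (fun y : ℝ => q * y ^ (q - 1)) Y := by
    have hc (f : ℝ → ℝ) : ContinuousOn f (spectrum ℝ Y) :=
      (Matrix.finite_real_spectrum (A := Y)).continuousOn f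
    rw [cfc_mul _ _ Y (hc _) (hc _), hYid]
  rw [hY1, mul_one] at e1
  rw [hX1, one_mul] at e2
  rw [hXid] at e3
  rw [hX1, one_mul, e5] at e4
  rw [sub_mul, trace_sub, Complex.sub_re, e1, e2, e3, e4]
  rw [← Finset.sum_sub_distrib, ← Finset.sum_add_distrib]
  refine Finset.sum_le_sum fun i _ => ?_
  rw [← Finset.sum_sub_distrib, ← Finset.sum_add_distrib]
  refine Finset.sum_le_sum fun j _ => ?_
  have h := mul_le_mul_of_nonneg_right
    (rpow_tangent_le (hX.eigenvalues_nonneg i) (hY.eigenvalues_pos j) hq)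
    (Complex.normSq_nonneg ((star (hX.1.eigenvectorUnitary : Matrix (Fin n) (Fin n) ℂ) *
        (hY.1.eigenvectorUnitary : Matrix (Fin n) (Fin n) ℂ)) i j))
  linarith

theorem re_trace_mul_nonneg {n : ℕ} {X Y : Matrix (Fin n) (Fin n) ℂ}
    (hX : X.PosSemidef) (hY : Y.PosSemidef) : 0 ≤ (trace (X * Y)).re := by
  have h := re_trace_cfc_mul_cfc hX.1 hY.1 (fun x => x) (fun x => x)
  have hXid : cfc (fun x : ℝ => x) X = X := cfc_id' ℝ X hX.1
  have hYid : cfc (fun x : ℝ => x) Y = Y := cfc_id' ℝ Y hY.1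
  rw [hXid, hYid] at h
  rw [h]
  exact Finset.sum_nonneg fun i _ => Finset.sum_nonneg fun j _ => mul_nonneg
    (mul_nonneg (hX.eigenvalues_nonneg i) (hY.eigenvalues_nonneg j)) (Complex.normSq_nonneg _)

/-- Midpoint convexity of `X ↦ trace (X ^ q)` on positive definite matrices. -/
theorem re_trace_cfc_rpow_midpoint_le {n : ℕ} {X Y : Matrix (Fin n) (Fin n) ℂ}
    (hX : X.PosDef) (hY : Y.PosDef) {q : ℝ} (hq : 1 ≤ q) :
    (trace (cfc (fun x : ℝ => x ^ q) (((1 : ℝ) / 2) • (X + Y)))).re ≤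
      ((trace (cfc (fun x : ℝ => x ^ q) X)).re + (trace (cfc (fun x : ℝ => x ^ q) Y)).re) / 2 := by
  have hZ : (((1 : ℝ) / 2) • (X + Y)).PosDef := (hX.add hY).smul (by norm_num)
  have h1 := klein_rpow hX.posSemidef hZ hq
  have h2 := klein_rpow hY.posSemidef hZ hq
  have hsub : Y - ((1 : ℝ) / 2) • (X + Y) = -(X - ((1 : ℝ) / 2) • (X + Y)) := by module
  rw [hsub, neg_mul, trace_neg, Complex.neg_re] at h2
  linarith

open scoped MatrixOrder Matrix.Norms.L2Operator in
/-- In-betweenness of the power mean for the Hilbert–Schmidt distance. -/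
theorem re_trace_sub_powerMean_le {n : ℕ} {A B : Matrix (Fin n) (Fin n) ℂ}
    (hA : A.PosDef) (hB : B.PosDef) {p : ℝ} (hp1 : 1 ≤ p) (hp2 : p ≤ 2)
    (hM : (((1 : ℝ) / 2) • (mpow A hA.1 p + mpow B hB.1 p)).IsHermitian) :
    (Matrix.trace ((A - mpow _ hM (1/p)) * (A - mpow _ hM (1/p)))).re ≤
      (Matrix.trace ((A - B) * (A - B))).re := by
  have hp0 : 0 < p := by linarith
  have hA0 : 0 ≤ A := hA.posSemidef.nonneg
  have hB0 : 0 ≤ B := hB.posSemidef.nonneg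
  have hP : (A ^ p).PosDef := (IsStrictlyPositive.rpow A p hA.isStrictlyPositive).posDef
  have hQ : (B ^ p).PosDef := (IsStrictlyPositive.rpow B p hB.isStrictlyPositive).posDef
  have hC : (((1 : ℝ) / 2) • (A ^ p + B ^ p)).PosDef := (hP.add hQ).smul (by norm_num)
  have eA := mpow_eq_rpow hA.1 hA0 p
  have eB := mpow_eq_rpow hB.1 hB0 p
  rw [← eA, ← eB] at hC
  rw [mpow_eq_rpow hM hC.posSemidef.nonneg, eA, eB]
  rw [eA, eB] at hC
  have root {X : Matrix (Fin n) (Fin n) ℂ} (hX : X.PosDef) : (X ^ p) ^ (1 / p) = X := by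
    rw [CFC.rpow_rpow X p _ hp0.ne' hX.isStrictlyPositive, mul_one_div_cancel hp0.ne',
      CFC.rpow_one X hX.posSemidef.nonneg]
  have sq {X : Matrix (Fin n) (Fin n) ℂ} (hX : X.PosDef) :
      X ^ (1 / p) * X ^ (1 / p) = cfc (fun x : ℝ => x ^ (1 / p + 1 / p)) X := by
    rw [← CFC.rpow_add hX.isStrictlyPositive.isUnit,
      CFC.rpow_eq_cfc_real hX.posSemidef.nonneg]
  have hconc := (CFC.concaveOn_rpow (A := Matrix (Fin n) (Fin n) ℂ) (p := 1 / p)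
    ⟨by positivity, (div_le_one hp0).2 hp1⟩).2 hP.posSemidef.nonneg hQ.posSemidef.nonneg
    (show (0 : ℝ) ≤ 1 / 2 by norm_num) (show (0 : ℝ) ≤ 1 / 2 by norm_num) (by norm_num)
  simp only [root hA, root hB, ← smul_add] at hconc
  have hconv := re_trace_cfc_rpow_midpoint_le hP hQ (q := 1 / p + 1 / p)
    (by rw [← add_div, le_div_iff₀ hp0]; linarith)
  rw [← sq hC, ← sq hP, ← sq hQ, root hA, root hB] at hconv
  set M := (((1 : ℝ) / 2) • (A ^ p + B ^ p)) ^ (1 / p)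
  have h1 := re_trace_mul_nonneg hA.posSemidef (Matrix.le_iff.1 hconc)
  have h2 : 0 ≤ (trace ((A - B) * (A - B))).re := by
    have h := (posSemidef_conjTranspose_mul_self (A - B)).trace_nonneg
    rw [(hA.1.sub hB.1).eq] at h
    exact (Complex.nonneg_iff.1 h).1
  simp only [mul_sub, sub_mul, mul_add, trace_sub, trace_add, mul_smul_comm, trace_smul,
    Complex.sub_re, Complex.add_re, Complex.real_smul, Complex.re_ofReal_mul,
    trace_mul_comm M A, trace_mul_comm B A] at h1 h2 ⊢
  linarith

theorem stmt4 {n : ℕ} (A B : Matrix (Fin n) (Fin n) ℂ)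
    (hA : A.PosDef) (hB : B.PosDef) (p : ℝ) (hp : p ∈ Set.Icc (1:ℝ) 2)
    (hM : (((1:ℝ)/2) • (mpow A hA.1 p + mpow B hB.1 p)).IsHermitian) :
    (Matrix.trace ((A - mpow _ hM (1/p)) * (A - mpow _ hM (1/p)))).re ≤
      (Matrix.trace ((A - B) * (A - B))).re := by
  exact re_trace_sub_powerMean_le hA hB hp.1 hp.2 hM
end

section
/- Let σ be a binary operation on positive definite matrices of the form A σ B = ∫₀¹ (t·A⁻¹ + (1-t)·B⁻¹)⁻¹ dν(t) for a probability measure ν on [0,1] (a Kubo–Ando mean). Then for all positive definite A, B: δ(A, A σ B) ≤ δ(A, B), where δ(A,B) = ‖log(A^(-1/2)·B·A^(-1/2))‖₂ is the trace metric. -/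
open Matrix MeasureTheory
open scoped ComplexOrder

section matFun

variable {n : ℕ} {A : Matrix (Fin n) (Fin n) ℂ} (hA : A.IsHermitian)

lemma star_eigenvectorUnitary_mul_self :
    star (hA.eigenvectorUnitary : Matrix (Fin n) (Fin n) ℂ) * hA.eigenvectorUnitary = 1 :=
  Unitary.coe_star_mul_self _

lemma eigenvectorUnitary_mul_star_self :
    (hA.eigenvectorUnitary : Matrix (Fin n) (Fin n) ℂ) *
      star (hA.eigenvectorUnitary : Matrix (Fin n) (Fin n) ℂ) = 1 :=
  Unitary.coe_mul_star_self _

lemma matFun_mul_matFun (g h : ℝ → ℝ) :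
    matFun A hA g * matFun A hA h = matFun A hA (fun x => g x * h x) := by
  unfold matFun
  simp only [Matrix.mul_assoc]
  rw [← Matrix.mul_assoc (star _) (hA.eigenvectorUnitary : Matrix (Fin n) (Fin n) ℂ),
    star_eigenvectorUnitary_mul_self, Matrix.one_mul, ← Matrix.mul_assoc (diagonal _) (diagonal _),
    diagonal_mul_diagonal]
  push_cast
  rfl

lemma matFun_congr {g h : ℝ → ℝ} (H : ∀ i, g (hA.eigenvalues i) = h (hA.eigenvalues i)) :
    matFun A hA g = matFun A hA h := by
  simp only [matFun, H]

lemma matFun_one : matFun A hA (fun _ => 1) = 1 := by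
  simp [matFun]

lemma matFun_id : matFun A hA (fun x => x) = A :=
  hA.spectral_theorem.symm

lemma star_matFun (g : ℝ → ℝ) : star (matFun A hA g) = matFun A hA g := by
  have hD : star (diagonal fun i => (g (hA.eigenvalues i) : ℂ)) =
      diagonal fun i => (g (hA.eigenvalues i) : ℂ) := by
    rw [star_eq_conjTranspose, diagonal_conjTranspose]
    congr 1
    ext i
    simp
  rw [matFun, star_mul, star_mul, star_star, hD, Matrix.mul_assoc]

lemma frob_matFun (g : ℝ → ℝ) :
    frob (matFun A hA g) = Real.sqrt (∑ i, g (hA.eigenvalues i) ^ 2) := by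
  rw [frob, star_matFun, matFun_mul_matFun, matFun, trace_mul_cycle,
    star_eigenvectorUnitary_mul_self, Matrix.one_mul, trace_diagonal, ← Complex.ofReal_sum,
    Complex.ofReal_re]
  simp only [sq]

lemma sum_eigenvalues_comp_eq_of_conj_diagonal {P Q : Matrix (Fin n) (Fin n) ℂ} (hQP : Q * P = 1)
    {d : Fin n → ℝ} (h : A = P * diagonal (fun i => (d i : ℂ)) * Q) (g : ℝ → ℝ) :
    ∑ i, g (hA.eigenvalues i) = ∑ i, g (d i) := by
  have hc : A.charpoly = (diagonal (fun i => (d i : ℂ))).charpoly := by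
    rw [h, charpoly_mul_comm, ← Matrix.mul_assoc, hQP, Matrix.one_mul]
  have hr := congrArg Polynomial.roots hc
  rw [hA.roots_charpoly_eq_eigenvalues, charpoly_diagonal, Polynomial.roots_prod _ _
    (by simp [Finset.prod_ne_zero_iff, Polynomial.X_sub_C_ne_zero])] at hr
  have hs := congrArg (fun s : Multiset ℂ => (s.map (fun z => g z.re)).sum) hr
  simpa [List.sum_ofFn] using hs

end matFun

lemma mpow_mul_mpow {n : ℕ} {A : Matrix (Fin n) (Fin n) ℂ} (hA : A.PosDef) (p q : ℝ) :
    mpow A hA.1 p * mpow A hA.1 q = mpow A hA.1 (p + q) := by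
  rw [mpow, mpow, mpow, matFun_mul_matFun]
  exact matFun_congr _ fun i => (Real.rpow_add (hA.eigenvalues_pos i) p q).symm

lemma mpow_zero {n : ℕ} {A : Matrix (Fin n) (Fin n) ℂ} (hA : A.IsHermitian) :
    mpow A hA 0 = 1 := by
  simp [mpow, matFun_one]

lemma mpow_one {n : ℕ} {A : Matrix (Fin n) (Fin n) ℂ} (hA : A.IsHermitian) :
    mpow A hA 1 = A := by
  simp [mpow, matFun_id]

lemma weighted_denominator_pos {x t : ℝ} (hx : 0 < x) (ht : t ∈ Set.Icc (0 : ℝ) 1) :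
    0 < t * x + (1 - t) := by
  rcases ht.1.eq_or_lt with rfl | h
  · simp
  · nlinarith [mul_pos h hx, ht.2]

lemma inv_weighted_sum_inv_eq {n : ℕ} {P Q : Matrix (Fin n) (Fin n) ℂ} (hP : IsUnit P)
    (hQ : IsUnit Q) {d : Fin n → ℝ} (hd : ∀ i, 0 < d i) {t : ℝ} (ht : t ∈ Set.Icc (0 : ℝ) 1) :
    (t • (P * Q)⁻¹ + (1 - t) • (P * diagonal (fun i => (d i : ℂ)) * Q)⁻¹)⁻¹ =
      P * diagonal (fun i => ((d i / (t * d i + (1 - t)) : ℝ) : ℂ)) * Q := by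
  have hinv : (diagonal (fun i => (d i : ℂ)))⁻¹ = diagonal (fun i => (((d i)⁻¹ : ℝ) : ℂ)) := by
    refine inv_eq_right_inv ?_
    rw [diagonal_mul_diagonal, ← diagonal_one]
    congr 1
    ext i
    simp [(hd i).ne']
  have hsum : t • (P * Q)⁻¹ + (1 - t) • (P * diagonal (fun i => (d i : ℂ)) * Q)⁻¹ =
      Q⁻¹ * diagonal (fun i => ((t + (1 - t) * (d i)⁻¹ : ℝ) : ℂ)) * P⁻¹ := by
    have hdiag : diagonal (fun i => ((t + (1 - t) * (d i)⁻¹ : ℝ) : ℂ)) =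
        t • (1 : Matrix (Fin n) (Fin n) ℂ) +
          (1 - t) • diagonal (fun i => (((d i)⁻¹ : ℝ) : ℂ)) := by
      ext i j
      by_cases h : i = j
      · subst h
        simp
      · simp [h]
    rw [Matrix.mul_inv_rev, Matrix.mul_inv_rev, Matrix.mul_inv_rev, hinv, hdiag]
    simp only [Matrix.mul_add, Matrix.add_mul, Matrix.mul_smul, Matrix.smul_mul, Matrix.mul_one,
      Matrix.mul_assoc]
  rw [hsum]
  refine inv_eq_right_inv ?_
  have hP' : P⁻¹ * P = 1 := nonsing_inv_mul _ ((isUnit_iff_isUnit_det _).1 hP)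
  have hQ' : Q⁻¹ * Q = 1 := nonsing_inv_mul _ ((isUnit_iff_isUnit_det _).1 hQ)
  have hD : diagonal (fun i => ((t + (1 - t) * (d i)⁻¹ : ℝ) : ℂ)) *
      diagonal (fun i => ((d i / (t * d i + (1 - t)) : ℝ) : ℂ)) = 1 := by
    rw [diagonal_mul_diagonal, ← diagonal_one]
    congr 1
    ext i
    rw [← Complex.ofReal_mul, ← Complex.ofReal_one]
    congr 1
    have h1 := (hd i).ne'
    have h2 := (weighted_denominator_pos (hd i) ht).ne'
    field_simp
  simp only [Matrix.mul_assoc]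
  rw [← Matrix.mul_assoc P⁻¹ P, hP', Matrix.one_mul, ← Matrix.mul_assoc (diagonal _) (diagonal _),
    hD, Matrix.one_mul, hQ']

lemma continuous_weighted_harmonic {x : ℝ} (hx : 0 < x) :
    Continuous fun t : Set.Icc (0 : ℝ) 1 => x / ((t : ℝ) * x + (1 - (t : ℝ))) :=
  continuous_const.div (by fun_prop) fun t => (weighted_denominator_pos hx t.2).ne'

lemma integrable_weighted_harmonic {x : ℝ} (hx : 0 < x) (ν : Measure (Set.Icc (0 : ℝ) 1))
    [IsProbabilityMeasure ν] :
    Integrable (fun t : Set.Icc (0 : ℝ) 1 => x / ((t : ℝ) * x + (1 - (t : ℝ)))) ν :=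
  (continuous_weighted_harmonic hx).integrable_of_hasCompactSupport
    (HasCompactSupport.of_compactSpace _)

lemma weighted_harmonic_mem_uIcc {x t : ℝ} (hx : 0 < x) (ht : t ∈ Set.Icc (0 : ℝ) 1) :
    x / (t * x + (1 - t)) ∈ Set.uIcc 1 x := by
  have hpos := weighted_denominator_pos hx ht
  obtain ⟨h0, h1⟩ := ht
  rw [Set.mem_uIcc, le_div_iff₀ hpos, div_le_iff₀ hpos, le_div_iff₀ hpos, div_le_iff₀ hpos]
  rcases le_total 1 x with h | h
  · left
    constructor <;> nlinarith [mul_nonneg h0 (sub_nonneg.2 h),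
      mul_nonneg (sub_nonneg.2 h1) (sub_nonneg.2 h), mul_nonneg hx.le
        (mul_nonneg h0 (sub_nonneg.2 h))]
  · right
    constructor <;> nlinarith [mul_nonneg h0 (sub_nonneg.2 h),
      mul_nonneg (sub_nonneg.2 h1) (sub_nonneg.2 h), mul_nonneg hx.le
        (mul_nonneg h0 (sub_nonneg.2 h))]

lemma integral_weighted_harmonic_mem_uIcc {x : ℝ} (hx : 0 < x) (ν : Measure (Set.Icc (0 : ℝ) 1))
    [IsProbabilityMeasure ν] :
    ∫ t, x / ((t : ℝ) * x + (1 - (t : ℝ))) ∂ν ∈ Set.uIcc 1 x :=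
  (convex_uIcc 1 x).integral_mem isClosed_Icc
    (.of_forall fun t => weighted_harmonic_mem_uIcc hx t.2) (integrable_weighted_harmonic hx ν)

lemma sq_log_le_sq_log_of_mem_uIcc {x y : ℝ} (hx : 0 < x) (hy : y ∈ Set.uIcc 1 x) :
    Real.log y ^ 2 ≤ Real.log x ^ 2 := by
  rcases Set.mem_uIcc.1 hy with ⟨h1, h2⟩ | ⟨h1, h2⟩
  · exact pow_le_pow_left₀ (Real.log_nonneg h1) (Real.log_le_log (by linarith) h2) 2
  · have h3 := Real.log_nonpos (hx.le.trans h1) h2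
    have h4 := Real.log_le_log hx h1
    nlinarith


theorem stmt19 {n : ℕ} (A B S : Matrix (Fin n) (Fin n) ℂ)
    (hA : A.PosDef) (hB : B.PosDef)
    (ν : Measure (Set.Icc (0:ℝ) 1)) (hν : IsProbabilityMeasure ν)
    (hS : ∀ i j, S i j = ∫ t, ((((t : ℝ)) • A⁻¹ + (1 - (t : ℝ)) • B⁻¹)⁻¹) i j ∂ν)
    (hM : (mpow A hA.1 (-(1/2)) * B * mpow A hA.1 (-(1/2))).IsHermitian)
    (hMS : (mpow A hA.1 (-(1/2)) * S * mpow A hA.1 (-(1/2))).IsHermitian) :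
    frob (matFun _ hMS Real.log) ≤ frob (matFun _ hM Real.log) := by
  have hWW' : mpow A hA.1 (-(1/2)) * mpow A hA.1 (1/2) = 1 := by
    rw [mpow_mul_mpow hA, neg_add_cancel, mpow_zero]
  have hW'W : mpow A hA.1 (1/2) * mpow A hA.1 (-(1/2)) = 1 := by
    rw [mpow_mul_mpow hA, add_neg_cancel, mpow_zero]
  have hA' : mpow A hA.1 (1/2) * mpow A hA.1 (1/2) = A := by
    rw [mpow_mul_mpow hA, add_halves, mpow_one]
  have hW : star (mpow A hA.1 (-(1/2))) = mpow A hA.1 (-(1/2)) := star_matFun _ _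
  set W := mpow A hA.1 (-(1/2))
  set W' := mpow A hA.1 (1/2)
  have hMpos : (W * B * W).PosDef := by
    have := hB.mul_mul_conjTranspose_same (B := W)
      (vecMul_injective_iff_isUnit.2 (IsUnit.of_mul_eq_one _ hWW'))
    rwa [← star_eq_conjTranspose, hW] at this
  have hd : ∀ i, 0 < hM.eigenvalues i := hMpos.eigenvalues_pos
  have hspec := matFun_id hM
  have hVV := eigenvectorUnitary_mul_star_self hM
  have hVV' := star_eigenvectorUnitary_mul_self hM
  unfold matFun at hspec
  rw [frob_matFun, frob_matFun]
  set d := hM.eigenvalues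
  set V := (hM.eigenvectorUnitary : Matrix (Fin n) (Fin n) ℂ)
  have hAPQ : A = (W' * V) * (star V * W') := by
    rw [Matrix.mul_assoc, ← Matrix.mul_assoc V, hVV, Matrix.one_mul, hA']
  have hBPQ : B = (W' * V) * diagonal (fun i => (d i : ℂ)) * (star V * W') := by
    calc B = W' * (W * B * W) * W' := by
          simp only [Matrix.mul_assoc, hWW', Matrix.mul_one]
          rw [← Matrix.mul_assoc, hW'W, Matrix.one_mul]
      _ = _ := by
          rw [← hspec]
          simp only [Matrix.mul_assoc]
  have hP : IsUnit (W' * V) :=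
    (IsUnit.of_mul_eq_one _ hW'W).mul (IsUnit.of_mul_eq_one _ hVV)
  have hQ : IsUnit (star V * W') :=
    (IsUnit.of_mul_eq_one _ hVV').mul (IsUnit.of_mul_eq_one _ hW'W)
  have hSPQ : S = (W' * V) * diagonal (fun i =>
      ((∫ t, d i / ((t : ℝ) * d i + (1 - (t : ℝ))) ∂ν : ℝ) : ℂ)) * (star V * W') := by
    ext i j
    have hint (t : Set.Icc (0 : ℝ) 1) :
        (((t : ℝ) • A⁻¹ + (1 - (t : ℝ)) • B⁻¹)⁻¹) i j = ∑ k, (W' * V) i k *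
          ((d k / ((t : ℝ) * d k + (1 - (t : ℝ))) : ℝ) : ℂ) * (star V * W') k j := by
      conv_lhs => rw [hAPQ, hBPQ]
      rw [inv_weighted_sum_inv_eq hP hQ hd t.2, Matrix.mul_apply]
      simp only [mul_diagonal]
    rw [hS, Matrix.mul_apply]
    simp only [hint, mul_diagonal]
    rw [integral_finsetSum _ fun k _ =>
      (((integrable_weighted_harmonic (hd k) ν).ofReal).const_mul _).mul_const _]
    refine Finset.sum_congr rfl fun k _ => ?_
    rw [integral_mul_const, integral_const_mul, integral_complex_ofReal]
  have hWSW : W * S * W = V * diagonal (fun i =>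
      ((∫ t, d i / ((t : ℝ) * d i + (1 - (t : ℝ))) ∂ν : ℝ) : ℂ)) * star V := by
    rw [hSPQ]
    simp only [Matrix.mul_assoc, hW'W, Matrix.mul_one]
    rw [← Matrix.mul_assoc W, hWW', Matrix.one_mul]
  rw [sum_eigenvalues_comp_eq_of_conj_diagonal hMS hVV' hWSW (fun x => Real.log x ^ 2)]
  exact Real.sqrt_le_sqrt (Finset.sum_le_sum fun i _ =>
    sq_log_le_sq_log_of_mem_uIcc (hd i) (integral_weighted_harmonic_mem_uIcc (hd i) ν))
end
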